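/- arXiv:1611.01478 — 2 statements merged into one kernel-verified Lean document; each statement's English description precedes it below -/
import Mathlib

section
/- For all integers n ≥ 2, d ≥ 0, ℓ ≥ 0 and r ≥ 0, the number of basketball walks of length n from 0 to 0 that visit 1 and are positive except at their extremities, having exactly d steps of value ±1, exactly ℓ steps that are odd +2-steps or even -2-steps, and exactly r steps that are odd -2-steps or even +2-steps, is equal to the number of binary trees with n leaves having exactly d double leaves, exactly ℓ left leaves, and exactly r right leaves. -/
/-- Height of a walk (given by its list of steps) after `i` steps. -/
def ht (s : List ℤ) (i : ℕ) : ℤ := (s.take i).sum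

/-- A basketball walk: every step lies in `{-2, -1, 1, 2}`. -/
def IsBasketball (s : List ℤ) : Prop := ∀ x ∈ s, x = -2 ∨ x = -1 ∨ x = 1 ∨ x = 2

/-- A C-walk: a basketball walk from 0 to 0 that visits 1 and is positive
except at its extremities. -/
def IsCWalk (s : List ℤ) : Prop :=
  IsBasketball s ∧ ht s s.length = 0 ∧
    (∀ i, 0 < i → i < s.length → 0 < ht s i) ∧ ∃ i, i ≤ s.length ∧ ht s i = 1

/-- A G-walk: a basketball walk from 0 to 1 that is positive except at the origin. -/
def IsGWalk (s : List ℤ) : Prop :=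
  IsBasketball s ∧ ht s s.length = 1 ∧ ∀ i, 1 ≤ i → i ≤ s.length → 0 < ht s i

/-- An A-walk (basketball excursion): a nonnegative basketball walk from 0 to 0. -/
def IsAWalk (s : List ℤ) : Prop :=
  IsBasketball s ∧ ht s s.length = 0 ∧ ∀ i, i ≤ s.length → 0 ≤ ht s i

/-- A B-walk: a basketball walk from 0 to 1 that visits 0 and 1 only at its extremities. -/
def IsBWalk (s : List ℤ) : Prop :=
  IsBasketball s ∧ ht s s.length = 1 ∧
    ∀ i, 0 < i → i < s.length → ht s i ≠ 0 ∧ ht s i ≠ 1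

/-- Number of `±1`-steps of a walk. -/
noncomputable def pmOneSteps (s : List ℤ) : ℕ :=
  Set.ncard {i : ℕ | i < s.length ∧ (s.getD i 0 = 1 ∨ s.getD i 0 = -1)}

/-- Number of steps that are odd `+2`-steps or even `-2`-steps
(the step of index `i`, 0-based, starts at height `ht s i`). -/
noncomputable def lSteps (s : List ℤ) : ℕ :=
  Set.ncard {i : ℕ | i < s.length ∧
    ((s.getD i 0 = 2 ∧ Odd (ht s i)) ∨ (s.getD i 0 = -2 ∧ Even (ht s i)))}

/-- Number of steps that are odd `-2`-steps or even `+2`-steps. -/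
noncomputable def rSteps (s : List ℤ) : ℕ :=
  Set.ncard {i : ℕ | i < s.length ∧
    ((s.getD i 0 = -2 ∧ Odd (ht s i)) ∨ (s.getD i 0 = 2 ∧ Even (ht s i)))}

/-- The (0-based) steps of indices `i < j` are paired: the `i`-th step is a `+2`,
the `j`-th step is a `-2`, the walk after step `j` is back at the height it had before
step `i`, and strictly in between the walk stays at least one above that height. -/
def Paired (s : List ℤ) (i j : ℕ) : Prop :=
  i < j ∧ j < s.length ∧ s.getD i 0 = 2 ∧ s.getD j 0 = -2 ∧
    ht s (j + 1) = ht s i ∧ ∀ k, i + 1 < k → k ≤ j → ht s i + 1 ≤ ht s k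

/-- A staggered `±2`-step: a `±2`-step that is not paired with any other `±2`-step. -/
def IsStaggered (s : List ℤ) (i : ℕ) : Prop :=
  i < s.length ∧ (s.getD i 0 = 2 ∨ s.getD i 0 = -2) ∧
    (∀ j, ¬ Paired s i j) ∧ ∀ j, ¬ Paired s j i

/-- Number of staggered `±2`-steps of a walk. -/
noncomputable def staggeredCount (s : List ℤ) : ℕ :=
  Set.ncard {i : ℕ | IsStaggered s i}
/-- Binary trees: every vertex has either 0 or 2 ordered children. -/
inductive FBTree where
  | leaf : FBTree
  | node : FBTree → FBTree → FBTree

/-- Number of leaves. -/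
def FBTree.leaves : FBTree → ℕ
  | .leaf => 1
  | .node l r => l.leaves + r.leaves

/-- Number of double leaves: leaves whose sibling is also a leaf. -/
def FBTree.doubleLeaves : FBTree → ℕ
  | .leaf => 0
  | .node .leaf .leaf => 2
  | .node l r => l.doubleLeaves + r.doubleLeaves

/-- Number of left leaves: leaves that are left children and whose sibling is not a leaf. -/
def FBTree.leftLeaves : FBTree → ℕ
  | .leaf => 0
  | .node .leaf .leaf => 0
  | .node .leaf r => 1 + r.leftLeaves
  | .node l .leaf => l.leftLeaves
  | .node l r => l.leftLeaves + r.leftLeaves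

/-- Number of right leaves: leaves that are right children and whose sibling is not a leaf. -/
def FBTree.rightLeaves : FBTree → ℕ
  | .leaf => 0
  | .node .leaf .leaf => 0
  | .node .leaf r => r.rightLeaves
  | .node l .leaf => 1 + l.rightLeaves
  | .node l r => l.rightLeaves + r.rightLeaves


section Algebra

variable {S : Type*} [CommRing S]

/-- The sequence with initial values `e₀, e₁` and recurrence
`e (h + 2) = α h * e (h + 1) + β h * e h`. -/
def linRec (α β : ℕ → S) (e₀ e₁ : S) : ℕ → S
  | 0 => e₀
  | 1 => e₁
  | h + 2 => α h * linRec α β e₀ e₁ (h + 1) + β h * linRec α β e₀ e₁ h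

/-- Weight of a down step of size two from height `h`. -/
def downWeight (L R : S) (h : ℕ) : S := if Even h then L else R

/-- Weight of an up step of size two from height `h`. -/
def upWeight (L R : S) (h : ℕ) : S := if Even h then R else L

/-- `E h` is the sum over the four possible first steps from height `h`, for `h ≥ 2`. -/
def FirstStepRec (D L R : S) (E : ℕ → S) : Prop :=
  ∀ h, E (h + 2) = D * E (h + 1) + downWeight L R h * E h + D * E (h + 3) +
    upWeight L R h * E (h + 4)

theorem firstStep_of_lastPassage {A D l r a a' b' x y : S}
    (h₁ : A * (1 - D * a' - r * (a * a' + A * l)) = 1)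
    (h₂ : a = A * (D + D * b' + r * a * b')) :
    a * x + A * l * y = D * x + l * y + D * (a' * (a * x + A * l * y) + b' * x) +
      r * (a * (a' * (a * x + A * l * y) + b' * x) + A * l * (a * x + A * l * y)) := by
  linear_combination (1 - D * a' - r * (a * a' + A * l)) * x * h₂ +
    ((D + D * b' + r * a * b') * x + l * y) * h₁

theorem linRec_firstStepRec {A D L R p q : S} (e₀ e₁ : S)
    (hA : A = 1 + A ^ 2 * D ^ 2 * p * q + L * R * A ^ 2)
    (hp : p * (1 - R * A) = 1) (hq : q * (1 - L * A) = 1) :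
    FirstStepRec D L R (linRec (fun h => A * D * if Even h then p else q)
      (fun h => A * downWeight L R h) e₀ e₁) := by
  intro h
  simp only [linRec, downWeight, upWeight]
  rcases Nat.even_or_odd h with he | ho
  · have h1 : ¬ Even (h + 1) := by simpa [parity_simps] using he
    have h2 : Even (h + 2) := by simpa [parity_simps] using he
    simp only [he, h1, h2, if_true, if_false]
    refine firstStep_of_lastPassage ?_ ?_
    · linear_combination hA + A ^ 2 * D ^ 2 * q * hp
    · linear_combination A * D * (1 + R * A) * hp
  · have h0 : ¬ Even h := by simpa using ho
    have h1 : Even (h + 1) := by simpa [parity_simps] using ho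
    have h2 : ¬ Even (h + 2) := by simpa [parity_simps] using ho
    simp only [h0, h1, h2, if_true, if_false]
    refine firstStep_of_lastPassage ?_ ?_
    · linear_combination hA + A ^ 2 * D ^ 2 * p * hq
    · linear_combination A * D * (1 + L * A) * hq

theorem exists_firstStepRec {A D L R p q T : S}
    (hA : A = 1 + A * T + L * R * A ^ 2)
    (hp : p * (1 - R * A) = 1) (hq : q * (1 - L * A) = 1)
    (hT : T = D ^ 2 + L * T + R * T + T ^ 2) :
    ∃ F V : ℕ → S, F 0 = 1 ∧ F 1 = D * F 0 + D * F 2 + L * F 3 ∧ FirstStepRec D L R F ∧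
      V 0 = 0 ∧ V 1 = F 1 ∧ FirstStepRec D L R V ∧ T = D * F 1 + R * V 2 := by
  have hk : (1 - T - L - R) * (A * p * q) = 1 := by
    linear_combination p * q * hA + q * (1 - L * A) * hp + hq
  have hTA : T = D ^ 2 * A * p * q := by
    linear_combination (A * p * q) * hT - T * hk
  have hA' : A = 1 + A ^ 2 * D ^ 2 * p * q + L * R * A ^ 2 := by
    linear_combination hA + A * hTA
  refine ⟨linRec (fun h => A * D * if Even h then p else q)
      (fun h => A * downWeight L R h) 1 (A * D * q),
    linRec (fun h => A * D * if Even h then p else q)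
      (fun h => A * downWeight L R h) 0 (A * D * q), rfl, ?_,
    linRec_firstStepRec _ _ hA' hp hq, rfl, rfl, linRec_firstStepRec _ _ hA' hp hq, ?_⟩
  · have h1 : A * (1 - D * (A * D * p) - L * (A * D * q * (A * D * p) + A * R)) = 1 := by
      linear_combination hA' + A ^ 2 * D ^ 2 * p * hq
    have h2 : A * D * q = A * (D + D * (A * L) + L * (A * D * q) * (A * L)) := by
      linear_combination A * D * (1 + L * A) * hq
    have := firstStep_of_lastPassage (x := 1) (y := 0) h1 h2
    simp only [linRec, downWeight, Nat.not_even_one, if_false, Even.zero, if_true]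
    linear_combination this
  · simp only [linRec, downWeight, Even.zero, if_true]
    linear_combination hTA + A * D ^ 2 * q * hp

end Algebra

section Series

open PowerSeries

variable {R : Type*} [CommRing R]

theorem exists_eq_one_add_mul_sq (u : R⟦X⟧) (hu : constantCoeff u = 0) :
    ∃ K : R⟦X⟧, K = 1 + u * K ^ 2 := by
  have hs : HasSubst u := HasSubst.of_constantCoeff_zero' hu
  refine ⟨substAlgHom (R := R) hs (PowerSeries.map (Nat.castRingHom R) catalanSeries), ?_⟩
  have h := congrArg (fun f => substAlgHom (R := R) hs (PowerSeries.map (Nat.castRingHom R) f))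
    catalanSeries_sq_mul_X_add_one
  simp only [map_add, map_mul, map_pow, map_one, PowerSeries.map_X, substAlgHom_X] at h
  linear_combination -h

theorem exists_eq_one_add_quadratic (u v : R⟦X⟧) (hu : constantCoeff u = 0)
    (hv : constantCoeff v = 0) : ∃ A : R⟦X⟧, A = 1 + A * u + v * A ^ 2 := by
  obtain ⟨w, hw⟩ := (isUnit_iff_constantCoeff (φ := 1 - u)).2 (by simp [hu])
  have hinv : (1 - u) * (↑w⁻¹ : R⟦X⟧) = 1 := by rw [← hw]; exact w.mul_inv
  obtain ⟨K, hK⟩ := exists_eq_one_add_mul_sq (v * (↑w⁻¹ : R⟦X⟧) ^ 2) (by simp [hv])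
  refine ⟨↑w⁻¹ * K, ?_⟩
  linear_combination hK + K * hinv

theorem exists_mul_one_sub_eq_one (u : R⟦X⟧) (hu : constantCoeff u = 0) :
    ∃ p : R⟦X⟧, p * (1 - u) = 1 := by
  obtain ⟨w, hw⟩ := (isUnit_iff_constantCoeff (φ := 1 - u)).2 (by simp [hu])
  exact ⟨↑w⁻¹, by rw [← hw]; exact w.inv_mul⟩

end Series

section Stats

open MvPolynomial

/-- The monomial `x₀ ^ a * x₁ ^ b * x₂ ^ c`. -/
noncomputable def statMonomial (a b c : ℕ) : MvPolynomial (Fin 3) ℤ :=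
  monomial (Finsupp.single 0 a + Finsupp.single 1 b + Finsupp.single 2 c) 1

theorem statMonomial_mul (a b c a' b' c' : ℕ) :
    statMonomial a b c * statMonomial a' b' c' = statMonomial (a + a') (b + b') (c + c') := by
  simp only [statMonomial, monomial_mul, mul_one, Finsupp.single_add]
  rw [add_add_add_comm, add_add_add_comm (Finsupp.single (0 : Fin 3) a)]

theorem statMonomial_zero : statMonomial 0 0 0 = 1 := by
  simp [statMonomial]

theorem coeff_statMonomial (a b c a' b' c' : ℕ) :
    coeff (Finsupp.single 0 a + Finsupp.single 1 b + Finsupp.single 2 c)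
      (statMonomial a' b' c') = if a' = a ∧ b' = b ∧ c' = c then 1 else 0 := by
  rw [statMonomial, coeff_monomial]
  refine if_congr ⟨fun h => ?_, fun ⟨h₁, h₂, h₃⟩ => by rw [h₁, h₂, h₃]⟩ rfl rfl
  have h0 := DFunLike.congr_fun h 0
  have h1 := DFunLike.congr_fun h 1
  have h2 := DFunLike.congr_fun h 2
  simp at h0 h1 h2
  exact ⟨h0, h1, h2⟩

theorem coeff_sum_statMonomial {ι : Type*} (s : Finset ι) (f g k : ι → ℕ) (a b c : ℕ) :
    coeff (Finsupp.single 0 a + Finsupp.single 1 b + Finsupp.single 2 c)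
      (∑ i ∈ s, statMonomial (f i) (g i) (k i)) =
      (Nat.card {i // i ∈ s ∧ f i = a ∧ g i = b ∧ k i = c} : ℤ) := by
  classical
  rw [coeff_sum]
  simp only [coeff_statMonomial]
  rw [Finset.sum_boole, Nat.card_congr (Equiv.subtypeEquivRight (q := (· ∈ s.filter
    fun i => f i = a ∧ g i = b ∧ k i = c)) fun i => by simp), Nat.card_eq_finsetCard]

end Stats

section Trees

namespace FBTree

theorem leaves_pos (t : FBTree) : 0 < t.leaves := by
  induction t with
  | leaf => simp [leaves]
  | node a b iha ihb => simp only [leaves]; omega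

theorem leaves_eq_one_iff (t : FBTree) : t.leaves = 1 ↔ t = leaf := by
  cases t with
  | leaf => simp [leaves]
  | node a b =>
    have := a.leaves_pos
    have := b.leaves_pos
    simp only [leaves, reduceCtorEq, iff_false]
    omega

theorem finite_leaves_le (n : ℕ) : {t : FBTree | t.leaves ≤ n}.Finite := by
  induction n with
  | zero =>
    refine Set.finite_empty.subset fun t ht => ?_
    have := t.leaves_pos
    simp only [Set.mem_ofPred_eq] at ht
    omega
  | succ n ih =>
    refine ((Set.finite_singleton leaf).union (ih.image2 node ih)).subset fun t ht => ?_
    cases t with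
    | leaf => simp
    | node a b =>
      have := a.leaves_pos
      have := b.leaves_pos
      simp only [leaves, Set.mem_ofPred_eq] at ht
      exact Or.inr ⟨a, by simp only [Set.mem_ofPred_eq]; omega, b,
        by simp only [Set.mem_ofPred_eq]; omega, rfl⟩

theorem finite_leaves_eq (n : ℕ) : {t : FBTree | t.leaves = n}.Finite :=
  (finite_leaves_le n).subset fun _ h => h.le

/-- The finite set of binary trees with `n` leaves. -/
noncomputable def withLeaves (n : ℕ) : Finset FBTree := (finite_leaves_eq n).toFinset

@[simp]
theorem mem_withLeaves {n : ℕ} {t : FBTree} : t ∈ withLeaves n ↔ t.leaves = n := by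
  simp [withLeaves]

theorem withLeaves_zero : withLeaves 0 = ∅ := by
  ext t
  simp [t.leaves_pos.ne']

theorem withLeaves_one : withLeaves 1 = {leaf} := by
  ext t
  simp [leaves_eq_one_iff]

variable {R : Type*} [CommRing R]

/-- Generating series, by number of leaves, of the binary trees weighted by `u`. -/
noncomputable def series (u : FBTree → R) : PowerSeries R :=
  PowerSeries.mk fun n => ∑ t ∈ withLeaves n, u t

/-- The product of the weights of the two principal subtrees, and zero on the leaf. -/
def splitWeight (u v : FBTree → R) : FBTree → R
  | leaf => 0
  | node a b => u a * v b

theorem series_mul (u v : FBTree → R) : series u * series v = series (splitWeight u v) := by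
  ext n
  simp only [series, PowerSeries.coeff_mul, PowerSeries.coeff_mk, Finset.sum_mul_sum,
    ← Finset.sum_product']
  rw [Finset.sum_sigma']
  refine Finset.sum_of_injOn (fun x => node x.2.1 x.2.2) ?_ ?_ ?_ ?_
  · rintro ⟨⟨i, j⟩, a, b⟩ h ⟨⟨i', j'⟩, a', b'⟩ h' heq
    simp only [Finset.coe_sigma, Finset.mem_coe, Set.mem_sigma_iff, Finset.mem_product,
      mem_withLeaves] at h h'
    obtain ⟨-, rfl, rfl⟩ := h
    obtain ⟨-, rfl, rfl⟩ := h'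
    simp only [node.injEq] at heq
    obtain ⟨rfl, rfl⟩ := heq
    rfl
  · rintro ⟨⟨i, j⟩, a, b⟩ h
    simp only [Finset.coe_sigma, Finset.mem_coe, Set.mem_sigma_iff, Finset.mem_product,
      mem_withLeaves] at h ⊢
    obtain ⟨h, rfl, rfl⟩ := h
    exact Finset.HasAntidiagonal.mem_antidiagonal.1 h
  · rintro (_ | ⟨a, b⟩) ht hn
    · rfl
    · exact absurd ⟨⟨(a.leaves, b.leaves), a, b⟩, by simpa [leaves] using ht, rfl⟩ hn
  · rintro ⟨⟨i, j⟩, a, b⟩ -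
    rfl

theorem series_add (u v : FBTree → R) : series u + series v = series (u + v) := by
  ext n
  simp [series, Finset.sum_add_distrib]

theorem C_mul_series (c : R) (u : FBTree → R) :
    PowerSeries.C c * series u = series (fun t => c * u t) := by
  ext n
  simp [series, Finset.mul_sum]

open Classical in
theorem series_leaf : series (fun t => if t = leaf then (1 : R) else 0) = PowerSeries.X := by
  ext n
  simp only [series, PowerSeries.coeff_mk, PowerSeries.coeff_X, Finset.sum_ite_eq',
    mem_withLeaves, leaves]
  simp only [eq_comm]

/-- The weight of a tree recording its double, left and right leaves; the leaf has weight zero. -/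
noncomputable def leafWeight (t : FBTree) : MvPolynomial (Fin 3) ℤ :=
  open Classical in
  if t = leaf then 0 else statMonomial t.doubleLeaves t.leftLeaves t.rightLeaves

theorem leafWeight_of_ne {t : FBTree} (h : t ≠ leaf) :
    leafWeight t = statMonomial t.doubleLeaves t.leftLeaves t.rightLeaves := if_neg h

open Classical in
theorem leafWeight_eq : leafWeight =
    (fun t => statMonomial 2 0 0 * splitWeight (fun t => if t = leaf then 1 else 0)
      (fun t => if t = leaf then 1 else 0) t) +
    (fun t => statMonomial 0 1 0 * splitWeight (fun t => if t = leaf then 1 else 0) leafWeight t) +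
    (fun t => statMonomial 0 0 1 * splitWeight leafWeight (fun t => if t = leaf then 1 else 0) t) +
    splitWeight leafWeight leafWeight := by
  funext t
  rcases t with _ | ⟨_ | ⟨a, b⟩, _ | ⟨c, d⟩⟩ <;>
  simp [leafWeight, splitWeight, statMonomial_mul, doubleLeaves, leftLeaves, rightLeaves, add_comm]

/-- The generating series of binary trees with at least two leaves is quadratic. -/
theorem series_leafWeight : series leafWeight =
    (PowerSeries.C (statMonomial 1 0 0) * PowerSeries.X) ^ 2 +
    (PowerSeries.C (statMonomial 0 1 0) * PowerSeries.X) * series leafWeight +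
    (PowerSeries.C (statMonomial 0 0 1) * PowerSeries.X) * series leafWeight +
    series leafWeight ^ 2 := by
  have h := congrArg series leafWeight_eq
  rw [← series_add, ← series_add, ← series_add, ← C_mul_series, ← C_mul_series, ← C_mul_series,
    ← series_mul, ← series_mul, ← series_mul, ← series_mul, series_leaf] at h
  have h2 : statMonomial 2 0 0 = statMonomial 1 0 0 ^ 2 := by
    rw [sq, statMonomial_mul]
  rw [h2, map_pow] at h
  linear_combination h

theorem coeff_zero_series_leafWeight : PowerSeries.constantCoeff (series leafWeight) = 0 := by
  rw [← PowerSeries.coeff_zero_eq_constantCoeff_apply]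
  simp [series, withLeaves_zero]

theorem coeff_series_leafWeight {n : ℕ} (hn : 2 ≤ n) :
    PowerSeries.coeff n (series leafWeight) =
      ∑ t ∈ withLeaves n, statMonomial t.doubleLeaves t.leftLeaves t.rightLeaves := by
  rw [series, PowerSeries.coeff_mk]
  refine Finset.sum_congr rfl fun t ht => leafWeight_of_ne ?_
  rintro rfl
  simp [leaves] at ht
  omega

end FBTree

end Trees

section Walks

theorem ht_zero (s : List ℤ) : ht s 0 = 0 := by simp [ht]

theorem ht_cons_succ (x : ℤ) (s : List ℤ) (i : ℕ) : ht (x :: s) (i + 1) = x + ht s i := by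
  simp [ht]

theorem ht_length (s : List ℤ) : ht s s.length = s.sum := by simp [ht]

/-- Number of steps `x` of a walk started at height `h` that start at a height `y` with `p x y`. -/
noncomputable def countSteps (p : ℤ → ℤ → Prop) (h : ℤ) (s : List ℤ) : ℕ :=
  Set.ncard {i : ℕ | i < s.length ∧ p (s.getD i 0) (h + ht s i)}

theorem countSteps_nil (p : ℤ → ℤ → Prop) (h : ℤ) : countSteps p h [] = 0 := by
  simp [countSteps]

open Classical in
theorem countSteps_cons (p : ℤ → ℤ → Prop) (h x : ℤ) (s : List ℤ) :
    countSteps p h (x :: s) = (if p x h then 1 else 0) + countSteps p (h + x) s := by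
  have hfin : {i : ℕ | i < s.length ∧ p (s.getD i 0) (h + x + ht s i)}.Finite :=
    (Set.finite_lt_nat s.length).subset fun i hi => hi.1
  have hset : {i : ℕ | i < (x :: s).length ∧ p ((x :: s).getD i 0) (h + ht (x :: s) i)} =
      {i | i = 0 ∧ p x h} ∪
        Nat.succ '' {i : ℕ | i < s.length ∧ p (s.getD i 0) (h + x + ht s i)} := by
    ext i
    cases i with
    | zero => simp [ht_zero]
    | succ i => simp [ht_cons_succ, add_assoc]
  rw [countSteps, hset, Set.ncard_union_eq ?_ ((Set.finite_singleton 0).subset fun i hi => hi.1)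
    (hfin.image _), Set.ncard_image_of_injective _ Nat.succ_injective]
  · congr 1
    split_ifs with hp <;> simp [hp]
  · rw [Set.disjoint_left]
    rintro i ⟨rfl, -⟩ ⟨j, -, hj⟩
    simp at hj

/-- Weight of a step `x` starting at height `h`. -/
noncomputable def stepWeight (h x : ℤ) : MvPolynomial (Fin 3) ℤ :=
  if x = 1 ∨ x = -1 then statMonomial 1 0 0
  else if (x = 2 ∧ Odd h) ∨ (x = -2 ∧ Even h) then statMonomial 0 1 0
  else statMonomial 0 0 1

/-- Product of the weights of the steps of a walk started at height `h`. -/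
noncomputable def walkWeight : ℤ → List ℤ → MvPolynomial (Fin 3) ℤ
  | _, [] => 1
  | h, x :: s => stepWeight h x * walkWeight (h + x) s

theorem walkWeight_eq (s : List ℤ) (hs : IsBasketball s) (h : ℤ) :
    walkWeight h s = statMonomial (countSteps (fun x _ => x = 1 ∨ x = -1) h s)
      (countSteps (fun x y => (x = 2 ∧ Odd y) ∨ (x = -2 ∧ Even y)) h s)
      (countSteps (fun x y => (x = -2 ∧ Odd y) ∨ (x = 2 ∧ Even y)) h s) := by
  induction s generalizing h with
  | nil => simp [walkWeight, countSteps_nil, statMonomial_zero]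
  | cons x s ih =>
    rw [walkWeight, ih (fun y hy => hs y (List.mem_cons_of_mem _ hy)), countSteps_cons,
      countSteps_cons, countSteps_cons, ← statMonomial_mul]
    congr 1
    rcases hs x List.mem_cons_self with rfl | rfl | rfl | rfl <;>
    rcases Int.even_or_odd h with hh | hh <;>
    simp [stepWeight, hh, Int.not_even_iff_odd.2, Int.not_odd_iff_even.2]

theorem walkWeight_zero (s : List ℤ) (hs : IsBasketball s) :
    walkWeight 0 s = statMonomial (pmOneSteps s) (lSteps s) (rSteps s) := by
  simp [walkWeight_eq s hs, countSteps, pmOneSteps, lSteps, rSteps]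

/-- The basketball walks of length `n`. -/
def walks : ℕ → Finset (List ℤ)
  | 0 => {[]}
  | n + 1 => (({1, -1, 2, -2} : Finset ℤ) ×ˢ walks n).image fun p => p.1 :: p.2

theorem mem_walks {n : ℕ} {s : List ℤ} : s ∈ walks n ↔ IsBasketball s ∧ s.length = n := by
  induction n generalizing s with
  | zero =>
    simp only [walks, Finset.mem_singleton, List.length_eq_zero_iff]
    exact ⟨by rintro rfl; simp [IsBasketball], fun h => h.2⟩
  | succ n ih =>
    cases s with
    | nil => simp [walks]
    | cons x s =>
      simp only [walks, Finset.mem_image, Finset.mem_product, ih, Prod.exists, List.cons.injEq,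
        IsBasketball, List.mem_cons, forall_eq_or_imp, List.length_cons, Finset.mem_insert,
        Finset.mem_singleton]
      constructor
      · rintro ⟨x, s, ⟨hx, hs, hn⟩, rfl, rfl⟩
        exact ⟨⟨by tauto, hs⟩, by omega⟩
      · rintro ⟨⟨hx, hs⟩, hn⟩
        exact ⟨x, s, ⟨by tauto, hs, by omega⟩, rfl, rfl⟩

theorem sum_walks_succ {M : Type*} [AddCommMonoid M] (n : ℕ) (f : List ℤ → M) :
    ∑ s ∈ walks (n + 1), f s = ∑ s ∈ walks n, f (1 :: s) + ∑ s ∈ walks n, f (-1 :: s) +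
      ∑ s ∈ walks n, f (2 :: s) + ∑ s ∈ walks n, f (-2 :: s) := by
  rw [walks, Finset.sum_image, Finset.sum_product]
  · simp [add_assoc]
  · rintro ⟨x, s⟩ - ⟨y, t⟩ - h
    simpa using h

/-- A walk started at height `h` that first reaches height `0` at its end. -/
def FirstHits (h : ℤ) (s : List ℤ) : Prop :=
  h + s.sum = 0 ∧ ∀ i < s.length, 0 < h + ht s i

/-- A walk started at height `h` that first reaches height `0` at its end and visits height `1`. -/
def FirstHitsVia (h : ℤ) (s : List ℤ) : Prop :=
  FirstHits h s ∧ ∃ i, i ≤ s.length ∧ h + ht s i = 1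

theorem firstHits_nil (h : ℤ) : FirstHits h [] ↔ h = 0 := by simp [FirstHits]

theorem firstHits_cons (h x : ℤ) (s : List ℤ) :
    FirstHits h (x :: s) ↔ 0 < h ∧ FirstHits (h + x) s := by
  simp only [FirstHits, List.sum_cons, List.length_cons, Nat.forall_lt_succ_left, ht_zero,
    ht_cons_succ, add_zero, add_assoc]
  tauto

theorem firstHitsVia_nil {h : ℤ} : ¬ FirstHitsVia h [] := by
  rintro ⟨h₀, i, -, hi⟩
  rw [firstHits_nil] at h₀
  simp [h₀, ht] at hi

theorem firstHitsVia_one (s : List ℤ) : FirstHitsVia 1 s ↔ FirstHits 1 s :=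
  ⟨fun h => h.1, fun h => ⟨h, 0, Nat.zero_le _, by simp [ht_zero]⟩⟩

theorem firstHitsVia_cons {h : ℤ} (hh : h ≠ 1) (x : ℤ) (s : List ℤ) :
    FirstHitsVia h (x :: s) ↔ 0 < h ∧ FirstHitsVia (h + x) s := by
  have key : (∃ i, i ≤ (x :: s).length ∧ h + ht (x :: s) i = 1) ↔
      ∃ i, i ≤ s.length ∧ h + x + ht s i = 1 := by
    constructor
    · rintro ⟨_ | i, hi, h1⟩
      · exact absurd (by simpa [ht_zero] using h1) hh
      · exact ⟨i, by simpa using hi, by rw [ht_cons_succ] at h1; rw [add_assoc]; exact h1⟩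
    · rintro ⟨i, hi, h1⟩
      exact ⟨i + 1, by simpa using hi, by rw [ht_cons_succ, ← add_assoc]; exact h1⟩
  rw [FirstHitsVia, firstHits_cons, key, FirstHitsVia, and_assoc]

theorem isCWalk_nil : ¬ IsCWalk [] := by
  rintro ⟨-, -, -, i, -, hi⟩
  simp [ht] at hi

theorem isCWalk_cons {x : ℤ} {s : List ℤ} (hs : IsBasketball (x :: s)) :
    IsCWalk (x :: s) ↔ FirstHitsVia x s := by
  constructor
  · rintro ⟨-, h0, hpos, i, hi, h1⟩
    refine ⟨⟨by rwa [ht_length, List.sum_cons] at h0, fun j hj => ?_⟩, ?_⟩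
    · rw [← ht_cons_succ]
      exact hpos _ j.succ_pos (by simpa using hj)
    · cases i with
      | zero => simp [ht_zero] at h1
      | succ i => exact ⟨i, by simpa using hi, by rw [← ht_cons_succ]; exact h1⟩
  · rintro ⟨⟨h0, hpos⟩, i, hi, h1⟩
    refine ⟨hs, by rwa [ht_length, List.sum_cons], fun j hj hj' => ?_, i + 1, by simpa using hi,
      by rw [ht_cons_succ]; exact h1⟩
    obtain ⟨j, rfl⟩ := Nat.exists_eq_succ_of_ne_zero hj.ne'
    rw [Nat.succ_eq_add_one, ht_cons_succ]
    exact hpos j (by simpa using hj')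

open Classical in
/-- Total weight of the walks of length `n` started at height `h` that satisfy `P h`. -/
noncomputable def walkSum (P : ℤ → List ℤ → Prop) (n : ℕ) (h : ℤ) : MvPolynomial (Fin 3) ℤ :=
  ∑ s ∈ walks n, if P h s then walkWeight h s else 0

theorem walkSum_succ {P : ℤ → List ℤ → Prop} {h : ℤ} {Q : ℤ → List ℤ → Prop}
    (hP : ∀ x s, IsBasketball (x :: s) → (P h (x :: s) ↔ Q (h + x) s)) (n : ℕ) :
    walkSum P (n + 1) h = stepWeight h 1 * walkSum Q n (h + 1) +
      stepWeight h (-1) * walkSum Q n (h - 1) + stepWeight h 2 * walkSum Q n (h + 2) +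
      stepWeight h (-2) * walkSum Q n (h - 2) := by
  classical
  have key : ∀ x : ℤ, (x = -2 ∨ x = -1 ∨ x = 1 ∨ x = 2) →
      (∑ s ∈ walks n, if P h (x :: s) then walkWeight h (x :: s) else 0) =
        stepWeight h x * walkSum Q n (h + x) := by
    intro x hx
    rw [walkSum, Finset.mul_sum]
    refine Finset.sum_congr rfl fun s hs => ?_
    have hb : IsBasketball (x :: s) := by
      simp only [IsBasketball, List.mem_cons, forall_eq_or_imp]
      exact ⟨hx, (mem_walks.1 hs).1⟩
    simp [hP x s hb, walkWeight]
  rw [walkSum, sum_walks_succ, key 1 (by simp), key (-1) (by simp), key 2 (by simp),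
    key (-2) (by simp), sub_eq_add_neg, sub_eq_add_neg]

theorem walkSum_eq_zero {P : ℤ → List ℤ → Prop} {n : ℕ} {h : ℤ}
    (hP : ∀ s ∈ walks n, ¬ P h s) : walkSum P n h = 0 := by
  classical
  exact Finset.sum_eq_zero fun s hs => if_neg (hP s hs)

theorem walkSum_congr {P Q : ℤ → List ℤ → Prop} {h : ℤ} (n : ℕ) (hPQ : ∀ s, P h s ↔ Q h s) :
    walkSum P n h = walkSum Q n h := by
  refine Finset.sum_congr rfl fun s _ => ?_
  by_cases hq : Q h s <;> simp [hPQ, hq]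

theorem not_firstHits_of_neg {h : ℤ} (hh : h < 0) (s : List ℤ) : ¬ FirstHits h s := by
  cases s with
  | nil => rw [firstHits_nil]; omega
  | cons x s => rw [firstHits_cons]; omega

/-- Variable marking `±1`-steps. -/
noncomputable abbrev serD : PowerSeries (MvPolynomial (Fin 3) ℤ) :=
  PowerSeries.C (statMonomial 1 0 0) * PowerSeries.X

/-- Variable marking odd `+2`-steps and even `-2`-steps. -/
noncomputable abbrev serL : PowerSeries (MvPolynomial (Fin 3) ℤ) :=
  PowerSeries.C (statMonomial 0 1 0) * PowerSeries.X

/-- Variable marking odd `-2`-steps and even `+2`-steps. -/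
noncomputable abbrev serR : PowerSeries (MvPolynomial (Fin 3) ℤ) :=
  PowerSeries.C (statMonomial 0 0 1) * PowerSeries.X

theorem stepWeight_one (h : ℤ) : stepWeight h 1 = statMonomial 1 0 0 := by simp [stepWeight]

theorem stepWeight_neg_one (h : ℤ) : stepWeight h (-1) = statMonomial 1 0 0 := by
  simp [stepWeight]

theorem stepWeight_two (h : ℕ) : stepWeight ((h : ℤ) + 2) 2 =
    upWeight (statMonomial 0 1 0) (statMonomial 0 0 1) h := by
  rcases Nat.even_or_odd h with hh | hh <;>
  simp [stepWeight, upWeight, hh, parity_simps, Nat.not_even_iff_odd.2, Nat.not_odd_iff_even.2]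

theorem stepWeight_neg_two (h : ℕ) : stepWeight ((h : ℤ) + 2) (-2) =
    downWeight (statMonomial 0 1 0) (statMonomial 0 0 1) h := by
  rcases Nat.even_or_odd h with hh | hh <;>
  simp [stepWeight, downWeight, hh, parity_simps, Nat.not_even_iff_odd.2]

theorem coeff_succ_C_mul_X_mul {R : Type*} [CommRing R] (c : R) (f : PowerSeries R) (n : ℕ) :
    PowerSeries.coeff (n + 1) (PowerSeries.C c * PowerSeries.X * f) =
      c * PowerSeries.coeff n f := by
  rw [mul_assoc, PowerSeries.coeff_C_mul, PowerSeries.coeff_succ_X_mul]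

theorem coeff_zero_of_firstStepRec {F : ℕ → PowerSeries (MvPolynomial (Fin 3) ℤ)}
    (hF : FirstStepRec serD serL serR F) (h : ℕ) : PowerSeries.coeff 0 (F (h + 2)) = 0 := by
  rw [hF h, downWeight, upWeight]
  split_ifs <;> simp

theorem coeff_succ_of_firstStepRec {F : ℕ → PowerSeries (MvPolynomial (Fin 3) ℤ)}
    (hF : FirstStepRec serD serL serR F) (n h : ℕ) :
    PowerSeries.coeff (n + 1) (F (h + 2)) =
      stepWeight ((h : ℤ) + 2) 1 * PowerSeries.coeff n (F (h + 3)) +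
      stepWeight ((h : ℤ) + 2) (-1) * PowerSeries.coeff n (F (h + 1)) +
      stepWeight ((h : ℤ) + 2) 2 * PowerSeries.coeff n (F (h + 4)) +
      stepWeight ((h : ℤ) + 2) (-2) * PowerSeries.coeff n (F h) := by
  rw [hF h, stepWeight_one, stepWeight_neg_one, stepWeight_two, stepWeight_neg_two, downWeight,
    upWeight, downWeight, upWeight]
  split_ifs <;> simp only [map_add, coeff_succ_C_mul_X_mul] <;> ring

theorem walkSum_eq_coeff {P : ℤ → List ℤ → Prop}
    {F : ℕ → PowerSeries (MvPolynomial (Fin 3) ℤ)} (hF : FirstStepRec serD serL serR F)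
    (hnil : ∀ h, 2 ≤ h → ¬ P h [])
    (hcons : ∀ h, 2 ≤ h → ∀ x s, P h (x :: s) ↔ P (h + x) s)
    (h0 : ∀ n, walkSum P n 0 = PowerSeries.coeff n (F 0)) (n : ℕ)
    (h1 : ∀ m ≤ n, walkSum P m 1 = PowerSeries.coeff m (F 1)) (h : ℕ) :
    walkSum P n h = PowerSeries.coeff n (F h) := by
  induction n generalizing h with
  | zero =>
    match h with
    | 0 => exact h0 0
    | 1 => exact h1 0 le_rfl
    | h + 2 =>
      rw [coeff_zero_of_firstStepRec hF]
      refine walkSum_eq_zero fun s hs => ?_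
      obtain rfl : s = [] := by simpa [walks] using hs
      exact hnil _ (by push_cast; omega)
  | succ n ih =>
    have ih' := ih fun m hm => h1 m (by omega)
    match h with
    | 0 => exact h0 _
    | 1 => exact h1 _ le_rfl
    | h + 2 =>
      rw [coeff_succ_of_firstStepRec hF, ← ih', ← ih', ← ih', ← ih',
        walkSum_succ (fun x s _ => hcons _ (by push_cast; omega) x s)]
      push_cast
      ring_nf

theorem walkSum_firstHits_zero (n : ℕ) :
    walkSum FirstHits n 0 = PowerSeries.coeff n (1 : PowerSeries (MvPolynomial (Fin 3) ℤ)) := by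
  cases n with
  | zero => simp [walkSum, walks, firstHits_nil, walkWeight]
  | succ n =>
    rw [PowerSeries.coeff_one, if_neg n.succ_ne_zero]
    refine walkSum_eq_zero fun s hs => ?_
    cases s with
    | nil => simp [walks] at hs
    | cons x s => rw [firstHits_cons]; omega

theorem walkSum_firstHits {F : ℕ → PowerSeries (MvPolynomial (Fin 3) ℤ)} (hF0 : F 0 = 1)
    (hF1 : F 1 = serD * F 0 + serD * F 2 + serL * F 3) (hF : FirstStepRec serD serL serR F)
    (n h : ℕ) : walkSum FirstHits n h = PowerSeries.coeff n (F h) := by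
  have h0 : ∀ n, walkSum FirstHits n 0 = PowerSeries.coeff n (F 0) := by
    intro n
    rw [hF0, walkSum_firstHits_zero]
  have main := walkSum_eq_coeff hF (P := FirstHits) (fun h hh => by rw [firstHits_nil]; omega)
    (fun h hh x s => by rw [firstHits_cons]; exact and_iff_right (by omega)) h0
  refine main n ?_ h
  induction n with
  | zero =>
    intro m hm
    obtain rfl : m = 0 := by omega
    rw [hF1]
    simp [walkSum, walks, firstHits_nil]
  | succ n ih =>
    intro m hm
    rcases Nat.lt_or_ge m (n + 1) with hlt | hge
    · exact ih m (by omega)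
    obtain rfl : m = n + 1 := by omega
    have e0 := main n ih 0
    have e2 := main n ih 2
    have e3 := main n ih 3
    have hneg : walkSum FirstHits n (1 - 2) = 0 :=
      walkSum_eq_zero fun s _ => not_firstHits_of_neg (by norm_num) s
    rw [walkSum_succ (Q := FirstHits)
      (fun x s _ => by rw [firstHits_cons]; exact and_iff_right (by omega)), hF1, hneg]
    push_cast at e0 e2 e3
    norm_num [e0, e2, e3, coeff_succ_C_mul_X_mul, stepWeight]
    ring

theorem walkSum_firstHitsVia {F V : ℕ → PowerSeries (MvPolynomial (Fin 3) ℤ)} (hF0 : F 0 = 1)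
    (hF1 : F 1 = serD * F 0 + serD * F 2 + serL * F 3) (hF : FirstStepRec serD serL serR F)
    (hV0 : V 0 = 0) (hV1 : V 1 = F 1) (hV : FirstStepRec serD serL serR V)
    (n h : ℕ) : walkSum FirstHitsVia n h = PowerSeries.coeff n (V h) := by
  refine walkSum_eq_coeff hV (fun h _ => firstHitsVia_nil)
    (fun h hh x s => by rw [firstHitsVia_cons (by omega)]; exact and_iff_right (by omega))
    (fun n => ?_) n (fun m _ => ?_) h
  · rw [hV0, map_zero]
    refine walkSum_eq_zero fun s _ => ?_
    cases s with
    | nil => exact firstHitsVia_nil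
    | cons x s => rw [firstHitsVia_cons (by omega)]; omega
  · have := walkSum_firstHits hF0 hF1 hF m 1
    rw [hV1, ← this]
    exact walkSum_congr m firstHitsVia_one

theorem not_firstHitsVia_of_neg {h : ℤ} (hh : h < 0) (s : List ℤ) : ¬ FirstHitsVia h s :=
  fun hs => not_firstHits_of_neg hh s hs.1

/-- The generating series of C-walks is that of binary trees with at least two leaves. -/
theorem walkSum_isCWalk {n : ℕ} (hn : n ≠ 0) :
    walkSum (fun _ => IsCWalk) n 0 =
      PowerSeries.coeff n (FBTree.series FBTree.leafWeight) := by
  obtain ⟨A, hA⟩ := exists_eq_one_add_quadratic (FBTree.series FBTree.leafWeight) (serL * serR)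
    FBTree.coeff_zero_series_leafWeight (by simp)
  obtain ⟨p, hp⟩ := exists_mul_one_sub_eq_one (serR * A) (by simp)
  obtain ⟨q, hq⟩ := exists_mul_one_sub_eq_one (serL * A) (by simp)
  obtain ⟨F, V, hF0, hF1, hF, hV0, hV1, hV, hT⟩ :=
    exists_firstStepRec hA hp hq FBTree.series_leafWeight
  have hvia := walkSum_firstHitsVia hF0 hF1 hF hV0 hV1 hV
  obtain ⟨n, rfl⟩ := Nat.exists_eq_succ_of_ne_zero hn
  have e1 := hvia n 1
  have e2 := hvia n 2
  rw [hT, Nat.succ_eq_add_one, walkSum_succ (Q := FirstHitsVia)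
      (fun x s hs => by rw [isCWalk_cons hs, zero_add]),
    walkSum_eq_zero fun s _ => not_firstHitsVia_of_neg (show (0 : ℤ) - 1 < 0 by norm_num) s,
    walkSum_eq_zero fun s _ => not_firstHitsVia_of_neg (show (0 : ℤ) - 2 < 0 by norm_num) s,
    ← hV1]
  push_cast at e1 e2
  simp [e1, e2, coeff_succ_C_mul_X_mul, stepWeight]

open Classical in
theorem walkSum_isCWalk_eq_sum (n : ℕ) :
    walkSum (fun _ => IsCWalk) n 0 =
      ∑ s ∈ walks n with IsCWalk s, statMonomial (pmOneSteps s) (lSteps s) (rSteps s) := by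
  rw [walkSum, Finset.sum_filter]
  refine Finset.sum_congr rfl fun s hs => ?_
  rw [walkWeight_zero s (mem_walks.1 hs).1]

end Walks

/-- C-walks of length `n` with given step statistics are equinumerous with binary trees
with `n` leaves and corresponding leaf statistics. -/
theorem stmt2 (n d l r : ℕ) (hn : 2 ≤ n) :
    Nat.card {s : List ℤ //
        IsCWalk s ∧ s.length = n ∧ pmOneSteps s = d ∧ lSteps s = l ∧ rSteps s = r} =
    Nat.card {t : FBTree //
        t.leaves = n ∧ t.doubleLeaves = d ∧ t.leftLeaves = l ∧ t.rightLeaves = r} := by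
  classical
  have h := walkSum_isCWalk (n := n) (by omega)
  rw [walkSum_isCWalk_eq_sum, FBTree.coeff_series_leafWeight hn] at h
  have hc := congrArg (MvPolynomial.coeff
    (Finsupp.single 0 d + Finsupp.single 1 l + Finsupp.single 2 r)) h
  rw [coeff_sum_statMonomial, coeff_sum_statMonomial, Nat.cast_inj] at hc
  simp only [FBTree.mem_withLeaves] at hc
  rw [← hc]
  refine Nat.card_congr (Equiv.subtypeEquivRight fun s => ?_)
  simp only [Finset.mem_filter, mem_walks]
  exact ⟨fun ⟨hs, hlen, h⟩ => ⟨⟨⟨hs.1, hlen⟩, hs⟩, h⟩, fun ⟨⟨⟨_, hlen⟩, hs⟩, h⟩ => ⟨hs, hlen, h⟩⟩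
end

section
/- For every integer n ≥ 1, the number of increasing unary-binary trees with n vertices whose associated permutation avoids 213 is equal to (1/n)·∑_{k=1}^{n} (-1)^{k+1}·binomial(2k-2, k-1)·binomial(2n, n-k). -/
/-- A sequence (list) avoids the pattern 213. -/
def Avoids213 (s : List ℕ) : Prop :=
  ∀ i1 i2 i3, i1 < i2 → i2 < i3 → i3 < s.length →
    ¬ (s.getD i2 0 < s.getD i1 0 ∧ s.getD i1 0 < s.getD i3 0)
/-- Labeled unary-binary trees: each vertex carries a label and has 0, 1 or 2 children. -/
inductive UBTree where
  | lf : ℕ → UBTree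
  | un : ℕ → UBTree → UBTree
  | bin : ℕ → UBTree → UBTree → UBTree

/-- Number of vertices. -/
def UBTree.size : UBTree → ℕ
  | .lf _ => 1
  | .un _ t => 1 + t.size
  | .bin _ l r => 1 + l.size + r.size

/-- Root label. -/
def UBTree.label : UBTree → ℕ
  | .lf a => a
  | .un a _ => a
  | .bin a _ _ => a

/-- Ordered list of children (subtrees) of the root. -/
def UBTree.children : UBTree → List UBTree
  | .lf _ => []
  | .un _ t => [t]
  | .bin _ l r => [l, r]

/-- The labeling is increasing: every child has a larger label than its parent. -/
def UBTree.increasing : UBTree → Prop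
  | .lf _ => True
  | .un a t => a < t.label ∧ t.increasing
  | .bin a l r => a < l.label ∧ a < r.label ∧ l.increasing ∧ r.increasing

/-- Number of unary nodes (vertices with exactly one child). -/
def UBTree.unaryCount : UBTree → ℕ
  | .lf _ => 0
  | .un _ t => 1 + t.unaryCount
  | .bin _ l r => l.unaryCount + r.unaryCount

/-- Breadth-first traversal of a queue of trees, recording `f` at each vertex;
the fuel bounds the number of vertices processed. -/
def bfsAux (f : UBTree → ℕ) : ℕ → List UBTree → List ℕ
  | 0, _ => []
  | _ + 1, [] => []
  | n + 1, t :: ts => f t :: bfsAux f n (ts ++ t.children)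

/-- Labels of the tree read in left-to-right breadth-first search order
(the fuel `t.size` is exactly the number of vertices, hence suffices). -/
def UBTree.bfs (t : UBTree) : List ℕ := bfsAux UBTree.label t.size [t]

/-- Arities (numbers of children) of the vertices read in left-to-right
breadth-first search order. -/
def UBTree.bfsArity (t : UBTree) : List ℕ :=
  bfsAux (fun t => t.children.length) t.size [t]

/-- An increasing unary-binary tree (vertices labeled bijectively with `1, ..., n`,
children having larger labels than their parents) whose associated permutation
(labels in breadth-first search order) avoids the pattern 213. -/
def IsGoodUB (t : UBTree) : Prop :=
  t.increasing ∧ t.bfs.Perm (List.range' 1 t.size) ∧ Avoids213 t.bfs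

section Series

open PowerSeries Finset

open scoped PowerSeries.WithPiTopology in
/-- A power series without constant term can be substituted for the variable of a power series
whose coefficients are themselves power series. -/
theorem PowerSeries.exists_evalRingHom {A : ℤ⟦X⟧} (hA : constantCoeff A = 0) :
    ∃ φ : ℤ⟦X⟧⟦X⟧ →+* ℤ⟦X⟧, (∀ s, φ (C s) = s) ∧ φ X = A := by
  let _ : UniformSpace ℤ := ⊥
  have : DiscreteTopology ℤ := ⟨rfl⟩
  have hA' : HasEval A :=
    PowerSeries.WithPiTopology.isTopologicallyNilpotent_of_constantCoeff_zero hA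
  exact ⟨eval₂Hom (φ := RingHom.id ℤ⟦X⟧) continuous_id hA',
    fun s ↦ by simp [coe_eval₂Hom, eval₂_C], by simp [coe_eval₂Hom, eval₂_X]⟩

/-- The generating series of the Catalan numbers, over the integers. -/
noncomputable def intCatalanSeries : ℤ⟦X⟧ := mk fun n ↦ (catalan n : ℤ)

local notation "𝒞" => intCatalanSeries

theorem intCatalanSeries_eq : 𝒞 = 1 + X * 𝒞 ^ 2 := by
  have h := congrArg (PowerSeries.map (Nat.castRingHom ℤ)) catalanSeries_sq_mul_X_add_one
  have h2 : PowerSeries.map (Nat.castRingHom ℤ) catalanSeries = 𝒞 := by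
    ext n; simp [intCatalanSeries]
  simp only [map_add, map_mul, map_pow, h2, map_one, map_X] at h
  linear_combination -h

theorem eq_of_eq_one_add_X_mul_sq {D E : ℤ⟦X⟧} (hD : D = 1 + X * D ^ 2) (hE : E = 1 + X * E ^ 2) :
    D = E := by
  have h : (D - E) * (1 - X * (D + E)) = 0 := by linear_combination hD - hE
  rcases mul_eq_zero.1 h with h | h
  · exact sub_eq_zero.1 h
  · simpa using congrArg constantCoeff h

/-- The kernel method: the first column of an array obeying the recurrence of good forests
has generating series `A` with `1 + A + A ^ 2` the Catalan series. -/
theorem one_add_add_sq_eq_catalan (f : ℕ → ℕ → ℕ) (h00 : f 0 0 = 1) (h0 : ∀ m, f 0 (m + 1) = 0)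
    (hs0 : ∀ n, f (n + 1) 0 = 0)
    (hs : ∀ n m, f (n + 1) (m + 1) = ∑ p ∈ antidiagonal m, catalan p.1 *
      if p.1 ≤ n then f (n - p.1) p.2 + f (n - p.1) (p.2 + 1) + f (n - p.1) (p.2 + 2) else 0) :
    let A : ℤ⟦X⟧ := mk fun n ↦ (f n 1 : ℤ)
    1 + A + A ^ 2 = 𝒞 := by
  intro A
  let col : ℕ → ℤ⟦X⟧ := fun m ↦ mk fun n ↦ (f n m : ℤ)
  let F : ℤ⟦X⟧⟦X⟧ := mk col
  let c : ℤ⟦X⟧⟦X⟧ := rescale X (PowerSeries.map C 𝒞)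
  let G : ℤ⟦X⟧⟦X⟧ := mk fun k ↦ col k + col (k + 1) + col (k + 2)
  have hc : c = 1 + C X * X * c ^ 2 := by
    have h := congrArg (fun s ↦ rescale X (PowerSeries.map (C : ℤ →+* ℤ⟦X⟧) s)) intCatalanSeries_eq
    simpa only [map_add, map_mul, map_pow, map_one, map_X, rescale_X, ← mul_assoc] using h
  have hcol0 : col 0 = 1 := by
    ext n
    rcases n with _ | n <;> simp [col, h00, hs0, coeff_one]
  have hF : F = 1 + C X * X * c * G := by
    ext1 m
    rcases m with _ | m
    · simp [F, hcol0]
    · rw [show C X * X * c * G = X * (C X * (c * G)) by ring, map_add, coeff_succ_X_mul,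
        coeff_C_mul, coeff_mul]
      ext n
      rcases n with _ | n
      · simp [F, col, h0, coeff_one]
      · simp only [map_add, coeff_succ_X_mul, map_sum]
        simp only [F, coeff_mk, col, hs, coeff_one, c, coeff_rescale, coeff_map, G, mul_assoc,
          coeff_X_pow_mul', coeff_C_mul, intCatalanSeries]
        push_cast
        simp only [map_zero, zero_add]
        refine sum_congr rfl fun p _ ↦ ?_
        split_ifs <;> simp
  have hG : X ^ 2 * G = X ^ 2 * F + X * (F - 1) + (F - 1 - X * C A) := by
    ext1 m
    rcases m with _ | _ | m
    · simp [F, hcol0, coeff_X_pow_mul']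
    · simp [F, hcol0, coeff_X_pow_mul', coeff_one, A, col]
    · simp [F, coeff_X_pow_mul', coeff_one, coeff_X, G, coeff_succ_X_mul]
  let H : ℤ⟦X⟧⟦X⟧ := mk fun m ↦ mk fun n ↦ (f (n + 1) (m + 2) : ℤ)
  have hH : F = 1 + X * C A + X ^ 2 * (C X * H) := by
    ext1 m
    rcases m with _ | _ | m
    · simp [F, hcol0]
    · simp [F, coeff_X_pow_mul', coeff_one, A, col]
    · ext n
      rcases n with _ | n <;>
      simp [F, col, H, coeff_X_pow_mul', coeff_one, coeff_X, h0, coeff_succ_X_mul]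
  have hA0 : constantCoeff A = 0 := by simp [A, h0]
  have hA1 : A ≠ 0 := fun h ↦ by
    have := congrArg (coeff 1) h
    simp [A, hs, h00, h0] at this
  obtain ⟨φ, hφC, hφX⟩ := exists_evalRingHom hA0
  replace hc := congrArg φ hc
  replace hF := congrArg φ hF
  replace hG := congrArg φ hG
  replace hH := congrArg φ hH
  simp only [map_add, map_mul, map_pow, map_sub, map_one, hφC, hφX] at hc hF hG hH
  have hne : φ F - 1 ≠ 0 := by
    intro h
    have h1 : A ^ 2 * (1 + X * φ H) = 0 := by linear_combination h - hH
    rcases mul_eq_zero.1 h1 with h | h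
    · exact hA1 (pow_eq_zero_iff (two_ne_zero) |>.1 h)
    · simpa using congrArg constantCoeff h
  have hker : A = X * φ c * (1 + A + A ^ 2) := by
    refine mul_left_cancel₀ (mul_ne_zero hne hA1) ?_
    linear_combination A ^ 2 * hF + X * A * φ c * hG
  have hγ : φ c * (1 + A) = 1 + A + A ^ 2 := by
    linear_combination (1 + A + A ^ 2) * hc - A * φ c * hker
  refine eq_of_eq_one_add_X_mul_sq ?_ intCatalanSeries_eq
  linear_combination (1 + A) * hker + X * (1 + A + A ^ 2) * hγ

theorem constantCoeff_intCatalanSeries : constantCoeff 𝒞 = 1 := by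
  simp [intCatalanSeries, ← coeff_zero_eq_constantCoeff_apply]

/-- The powers of `V = 𝒞 - 1`, times the central binomial series, are the series of the
columns of the binomial coefficients `(2 * n).choose (n + k)`. -/
theorem coeff_intCatalanSeries_sub_one_pow_mul {T : ℤ⟦X⟧} (hT : (1 - 2 * X * 𝒞) * T = 1)
    (n k : ℕ) : coeff n ((𝒞 - 1) ^ k * T) = ((2 * n).choose (n + k) : ℤ) := by
  have hC := intCatalanSeries_eq
  induction n generalizing k with
  | zero =>
    have hT0 : constantCoeff T = 1 := by simpa using congrArg constantCoeff hT
    rcases k with _ | k <;> simp [hT0, constantCoeff_intCatalanSeries]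
  | succ n ih =>
    rcases k with _ | k
    · have h : (𝒞 - 1) ^ 0 * T = 1 + X * (2 * ((𝒞 - 1) ^ 0 * T + (𝒞 - 1) ^ 1 * T)) := by
        linear_combination hT
      rw [h, map_add, coeff_succ_X_mul, two_mul ((𝒞 - 1) ^ 0 * T + _), map_add, map_add, ih, ih]
      have h1 := Nat.choose_symm_half n
      have h2 := Nat.choose_succ_succ (2 * n + 1) n
      have h3 := Nat.choose_succ_succ (2 * n) n
      rw [show 2 * (n + 1) = 2 * n + 1 + 1 by ring]
      simp only [Nat.succ_eq_add_one, add_zero] at *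
      rw [h2, ← h1, h3]
      simp [coeff_one]
    · have h : (𝒞 - 1) ^ (k + 1) * T = X * ((𝒞 - 1) ^ k * T + ((𝒞 - 1) ^ (k + 1) * T +
          (𝒞 - 1) ^ (k + 1) * T) + (𝒞 - 1) ^ (k + 2) * T) := by
        linear_combination (𝒞 - 1) ^ k * T * hC
      rw [h, coeff_succ_X_mul]
      simp only [map_add, ih]
      have h1 := Nat.choose_succ_succ (2 * n + 1) (n + k + 1)
      have h2 := Nat.choose_succ_succ (2 * n) (n + k)
      have h3 := Nat.choose_succ_succ (2 * n) (n + k + 1)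
      rw [show 2 * (n + 1) = 2 * n + 1 + 1 by ring, show n + 1 + (k + 1) = n + k + 1 + 1 by ring]
      simp only [Nat.succ_eq_add_one, ← add_assoc] at *
      rw [h1, h2, h3]
      push_cast
      ring

/-- Lagrange inversion for the powers of the Catalan series minus one. -/
theorem mul_coeff_intCatalanSeries_sub_one_pow (n k : ℕ) :
    (n : ℤ) * coeff n ((𝒞 - 1) ^ (k + 1)) = (k + 1) * ((2 * n).choose (n + (k + 1)) : ℤ) := by
  have hC := intCatalanSeries_eq
  obtain ⟨T, hT⟩ : ∃ T : ℤ⟦X⟧, (1 - 2 * X * 𝒞) * T = 1 :=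
    ⟨_, mul_invOfUnit _ 1 (by simp)⟩
  have hD := congrArg (d⁄dX ℤ) hC
  simp only [map_add, Derivation.leibniz, Derivation.leibniz_pow, smul_eq_mul,
    Derivation.map_one_eq_zero, derivative_X, nsmul_eq_mul] at hD
  push_cast at hD
  have hD' : X * d⁄dX ℤ 𝒞 = (𝒞 - 1) * T := by
    linear_combination X * T * hD - T * hC - X * d⁄dX ℤ 𝒞 * hT
  have h : X * d⁄dX ℤ ((𝒞 - 1) ^ (k + 1)) = C ((k : ℤ) + 1) * ((𝒞 - 1) ^ (k + 1) * T) := by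
    simp only [Derivation.leibniz_pow, map_sub, Derivation.map_one_eq_zero, smul_eq_mul,
      nsmul_eq_mul]
    simp
    linear_combination (k + 1) * (𝒞 - 1) ^ k * hD'
  rw [← coeff_intCatalanSeries_sub_one_pow_mul hT, ← coeff_C_mul _ _ ((k : ℤ) + 1), ← h]
  rcases n with _ | n
  · simp
  · rw [coeff_succ_X_mul, coeff_derivative]
    push_cast
    ring

theorem mul_coeff_eq_sum_of_one_add_add_sq {A : ℤ⟦X⟧} (hA0 : constantCoeff A = 0)
    (hA : 1 + A + A ^ 2 = 𝒞) (n : ℕ) :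
    (n : ℤ) * coeff n A = ∑ k ∈ Icc 1 n, (-1 : ℤ) ^ (k + 1) *
      ((2 * k - 2).choose (k - 1) : ℤ) * ((2 * n).choose (n - k) : ℤ) := by
  have hV : HasSubst (𝒞 - 1) :=
    .of_constantCoeff_zero' (by simp [constantCoeff_intCatalanSeries])
  let W : ℤ⟦X⟧ := X * rescale (-1) 𝒞
  have hW : W = X - W ^ 2 := by
    have h := congrArg (rescale (-1 : ℤ)) intCatalanSeries_eq
    simp only [map_add, map_mul, map_pow, map_one, rescale_X, map_neg] at h
    linear_combination X * h
  have hA' : A = W.subst (𝒞 - 1) := by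
    have h := congrArg (substAlgHom (R := ℤ) hV) hW
    simp only [map_sub, map_pow, coe_substAlgHom, subst_X hV] at h
    have h0 : constantCoeff (W.subst (𝒞 - 1) : ℤ⟦X⟧) = 0 := by
      have : W.subst (𝒞 - 1) = (𝒞 - 1) * (rescale (-1) 𝒞).subst (𝒞 - 1) := by
        rw [subst_mul hV, subst_X hV]
      rw [this]
      simp [constantCoeff_intCatalanSeries]
    have h1 : (A - W.subst (𝒞 - 1)) * (1 + A + W.subst (𝒞 - 1)) = 0 := by
      linear_combination hA - h
    rcases mul_eq_zero.1 h1 with h | h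
    · exact sub_eq_zero.1 h
    · simpa [hA0, h0] using congrArg constantCoeff h
  have hV0 (d : ℕ) (hd : n < d) : coeff n ((𝒞 - 1) ^ d) = 0 := by
    refine coeff_of_lt_order _ (lt_of_lt_of_le (Nat.cast_lt.2 hd) ?_)
    exact le_order_pow_of_constantCoeff_eq_zero d (by simp [constantCoeff_intCatalanSeries])
  rw [hA', coeff_subst' hV, finsum_eq_sum_of_support_subset (s := range (n + 1)), mul_sum,
    sum_range_succ', range_eq_Ico,
    sum_Ico_add' (fun d ↦ (n : ℤ) * (coeff d W • coeff n ((𝒞 - 1) ^ d))) 0 n 1]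
  · simp only [W, coeff_zero_X_mul, zero_smul, mul_zero, add_zero, zero_add]
    refine sum_congr rfl fun k hk ↦ ?_
    obtain ⟨j, rfl⟩ : ∃ j, k = j + 1 := ⟨k - 1, by simp at hk; omega⟩
    rw [coeff_succ_X_mul, coeff_rescale, smul_eq_mul, mul_left_comm,
      mul_coeff_intCatalanSeries_sub_one_pow]
    have h1 : (2 * n).choose (n - (j + 1)) = (2 * n).choose (n + (j + 1)) :=
      Nat.choose_symm_of_eq_add (by simp at hk; omega)
    have h2 : (2 * (j + 1) - 2).choose (j + 1 - 1) = (j + 1) * catalan j := by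
      rw [succ_mul_catalan_eq_centralBinom, Nat.centralBinom]; rfl
    rw [h1, h2, intCatalanSeries, coeff_mk]
    push_cast
    ring
  · intro d hd
    by_contra h
    exact hd (by simp [hV0 d (by simpa using h)])

end Series

section Forests

open Finset.HasAntidiagonal (antidiagonal mem_antidiagonal)

theorem avoids213_iff_triplewise (s : List ℕ) :
    Avoids213 s ↔ s.Triplewise fun x y z ↦ ¬ (y < x ∧ x < z) := by
  rw [List.triplewise_iff_getElem]
  refine forall₃_congr fun i j k ↦ forall₃_congr fun hij hjk hk ↦ ?_
  rw [List.getD_eq_getElem _ _ (by omega), List.getD_eq_getElem _ _ (by omega),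
    List.getD_eq_getElem _ _ hk]

/-- The list `s` is a 213-avoiding permutation of `a, a + 1, ..., a + n - 1`. -/
def IsPerm213 (a n : ℕ) (s : List ℕ) : Prop :=
  s.Perm (List.range' a n) ∧ Avoids213 s

namespace IsPerm213

variable {a n : ℕ} {s : List ℕ}

theorem length_eq (h : IsPerm213 a n s) : s.length = n := by
  simpa using h.1.length_eq

theorem mem_iff (h : IsPerm213 a n s) {x : ℕ} : x ∈ s ↔ a ≤ x ∧ x < a + n := by
  rw [h.1.mem_iff, List.mem_range'_1]

theorem nodup (h : IsPerm213 a n s) : s.Nodup :=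
  h.1.nodup_iff.2 List.nodup_range'

theorem notMem_of_lt (h : IsPerm213 a n s) {x : ℕ} (hx : x < a) : x ∉ s := fun hs ↦
  (h.mem_iff.1 hs).1.not_gt hx

end IsPerm213

theorem isPerm213_zero_iff {a : ℕ} {s : List ℕ} : IsPerm213 a 0 s ↔ s = [] := by
  refine ⟨fun h ↦ by simpa using h.1, ?_⟩
  rintro rfl
  exact ⟨by simp, by simp [avoids213_iff_triplewise]⟩

theorem perm_range'_of_forall_lt {L W : List ℕ} {a : ℕ}
    (h : (L ++ W).Perm (List.range' a (L ++ W).length)) (hlt : ∀ x ∈ L, ∀ y ∈ W, y < x) :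
    L.Perm (List.range' (a + W.length) L.length) ∧ W.Perm (List.range' a W.length) := by
  have hs : W.mergeSort ++ L.mergeSort = List.range' a (W.length + L.length) := by
    refine List.Perm.eq_of_pairwise (le := (· ≤ ·)) (fun x y _ _ ↦ le_antisymm) ?_ ?_ ?_
    · rw [List.pairwise_append]
      refine ⟨List.pairwise_mergeSort' (· ≤ ·) W, List.pairwise_mergeSort' (· ≤ ·) L,
        fun y hy x hx ↦ ?_⟩
      exact (hlt x (List.mem_mergeSort.1 hx) y (List.mem_mergeSort.1 hy)).le
    · exact List.pairwise_le_range'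
    · rw [List.length_append, add_comm] at h
      exact ((W.mergeSort_perm _).append (L.mergeSort_perm _)).trans (List.perm_append_comm.trans h)
  rw [← List.range'_append_1] at hs
  obtain ⟨h1, h2⟩ := List.append_inj hs (by simp)
  exact ⟨h2 ▸ (L.mergeSort_perm _).symm, h1 ▸ (W.mergeSort_perm _).symm⟩

/-- Splitting a 213-avoiding permutation at its minimum. -/
theorem isPerm213_append_cons_iff {a ℓ r : ℕ} {L W : List ℕ} (hL : L.length = ℓ) :
    IsPerm213 a (ℓ + r + 1) (L ++ a :: W) ↔
      IsPerm213 (a + 1 + r) ℓ L ∧ IsPerm213 (a + 1) r W := by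
  simp only [IsPerm213, avoids213_iff_triplewise]
  constructor
  · rintro ⟨hp, ha⟩
    rw [List.triplewise_append, List.triplewise_cons] at ha
    obtain ⟨haL, ⟨-, haW⟩, haLW, -⟩ := ha
    have hnd : (L ++ a :: W).Nodup := hp.nodup_iff.2 List.nodup_range'
    rw [List.nodup_append] at hnd
    have hle : ∀ x ∈ L ++ a :: W, a ≤ x := fun x hx ↦ by
      rw [hp.mem_iff, List.mem_range'_1] at hx; exact hx.1
    have hW : W.length = r := by
      have := hp.length_eq
      simp at this
      omega
    have hp' : (L ++ W).Perm (List.range' (a + 1) (L ++ W).length) := by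
      have := List.perm_middle.symm.trans hp
      rw [List.range'_succ] at this
      simpa [hL, hW] using this.cons_inv
    have := perm_range'_of_forall_lt hp' fun x hx y hy ↦ by
      have h1 := List.pairwise_cons.1 (haLW x hx)
      have h2 := h1.1 y hy
      have h3 := hnd.2.2 x hx a (by simp)
      have h4 := hnd.2.2 x hx y (by simp [hy])
      have h5 := hle x (by simp [hx])
      omega
    rw [hL, hW] at this
    exact ⟨⟨this.1, haL⟩, this.2, haW⟩
  · rintro ⟨⟨hpL, haL⟩, hpW, haW⟩
    have hL' : ∀ x ∈ L, a + 1 + r ≤ x := fun x hx ↦ by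
      rw [hpL.mem_iff, List.mem_range'_1] at hx; exact hx.1
    have hW' : ∀ x ∈ W, a < x ∧ x < a + 1 + r := fun x hx ↦ by
      rw [hpW.mem_iff, List.mem_range'_1] at hx; exact hx
    refine ⟨?_, ?_⟩
    · refine List.perm_middle.trans ?_
      rw [List.range'_succ]
      refine List.Perm.cons a (List.perm_append_comm.trans ((hpW.append hpL).trans ?_))
      rw [List.range'_append_1, add_comm r]
    · rw [List.triplewise_append, List.triplewise_cons]
      refine ⟨haL, ⟨?_, haW⟩, fun x hx ↦ ?_, fun z hz ↦ ?_⟩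
      · exact List.pairwise_of_forall_mem_list fun y hy z _ h ↦ by have := hW' y hy; omega
      · refine List.pairwise_of_forall_mem_list fun y _ z hz h ↦ ?_
        have := hL' x hx
        rcases List.mem_cons.1 hz with rfl | hz
        · omega
        · have := hW' z hz
          omega
      · refine List.pairwise_of_forall_mem_list fun x hx y _ h ↦ ?_
        have := hL' x hx
        rcases List.mem_cons.1 hz with rfl | hz
        · omega
        · have := hW' z hz
          omega

theorem prefix_eq_of_append_cons_eq {α : Type*} {a : α} {L L' W W' : List α} (h : a ∉ L)
    (h' : a ∉ L') (heq : L ++ a :: W = L' ++ a :: W') : L = L' := by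
  induction L generalizing L' with
  | nil => rcases L' with _ | ⟨b, L'⟩ <;> simp_all
  | cons b L ih =>
    rcases L' with _ | ⟨c, L'⟩
    · simp_all
    · simp only [List.cons_append, List.cons.injEq, List.mem_cons, not_or] at h h' heq
      rw [heq.1, ih h.2 h'.2 heq.2]

instance finite_isPerm213 (a n : ℕ) : Finite {s // IsPerm213 a n s} := by
  refine Set.Finite.to_subtype (s := {s | IsPerm213 a n s})
    ((List.range' a n).permutations.toFinset.finite_toSet.subset fun s hs ↦ ?_)
  simpa using hs.1

theorem card_isPerm213 (a n : ℕ) : Nat.card {s // IsPerm213 a n s} = catalan n := by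
  induction n using Nat.strong_induction_on generalizing a with
  | _ n ih =>
    rcases n with _ | n
    · simp [isPerm213_zero_iff]
    · let f : (Σ p : antidiagonal n, {L // IsPerm213 (a + 1 + p.1.2) p.1.1 L} ×
          {W // IsPerm213 (a + 1) p.1.2 W}) → {s // IsPerm213 a (n + 1) s} := fun x ↦
        ⟨x.2.1.1 ++ a :: x.2.2.1, by
          have h := (isPerm213_append_cons_iff x.2.1.2.length_eq).2 ⟨x.2.1.2, x.2.2.2⟩
          rwa [mem_antidiagonal.1 x.1.2] at h⟩
      have hf : f.Bijective := by
        constructor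
        · rintro ⟨⟨⟨l, r⟩, _⟩, ⟨L, hL⟩, W, hW⟩ ⟨⟨⟨l', r'⟩, _⟩, ⟨L', hL'⟩, W', hW'⟩ h
          simp only [f, Subtype.mk.injEq] at h
          simp only at hL hL' hW hW'
          rw [List.append_cons_inj_of_notMem (hL.notMem_of_lt (by omega))
            (hW.notMem_of_lt (by omega))] at h
          obtain ⟨rfl, -, rfl⟩ := h
          obtain rfl := hL.length_eq.symm.trans hL'.length_eq
          obtain rfl := hW.length_eq.symm.trans hW'.length_eq
          rfl
        · rintro ⟨s, hs⟩
          obtain ⟨L, W, rfl⟩ := List.append_of_mem ((hs.mem_iff (x := a)).2 (by omega))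
          have hn : L.length + W.length = n := by
            have := hs.length_eq
            simp at this
            omega
          have := hs
          rw [← hn, isPerm213_append_cons_iff rfl] at this
          exact ⟨⟨⟨(L.length, W.length), by simpa using hn⟩, ⟨L, this.1⟩, W, this.2⟩, rfl⟩
      rw [← Nat.card_eq_of_bijective f hf, Nat.card_sigma, catalan_succ',
        ← Finset.sum_coe_sort (antidiagonal n)]
      refine Finset.sum_congr rfl fun p _ ↦ ?_
      have hp := mem_antidiagonal.1 p.2
      rw [Nat.card_prod, ih _ (by omega), ih _ (by omega)]

theorem UBTree.increasing_iff_children (t : UBTree) :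
    t.increasing ↔ ∀ c ∈ t.children, t.label < c.label ∧ c.increasing := by
  cases t <;> simp [UBTree.increasing, UBTree.children, UBTree.label]
  tauto

/-- Total number of vertices of a queue of trees. -/
def queueSize (Q : List UBTree) : ℕ := (Q.map UBTree.size).sum

/-- Labels of a queue of trees in breadth-first order. -/
def queueBfs (Q : List UBTree) : List ℕ := bfsAux UBTree.label (queueSize Q) Q

theorem queueSize_cons (t : UBTree) (ts : List UBTree) :
    queueSize (t :: ts) = queueSize (ts ++ t.children) + 1 := by
  cases t <;> simp [queueSize, UBTree.size, UBTree.children] <;> omega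

@[simp] theorem queueBfs_nil : queueBfs [] = [] := rfl

theorem queueBfs_cons (t : UBTree) (ts : List UBTree) :
    queueBfs (t :: ts) = t.label :: queueBfs (ts ++ t.children) := by
  rw [queueBfs, queueSize_cons, bfsAux, queueBfs]

theorem length_queueBfs (Q : List UBTree) : (queueBfs Q).length = queueSize Q := by
  generalize hn : queueSize Q = n
  induction n generalizing Q with
  | zero =>
    rcases Q with _ | ⟨t, ts⟩
    · rfl
    · rw [queueSize_cons] at hn; omega
  | succ n ih =>
    rcases Q with _ | ⟨t, ts⟩
    · cases hn
    · rw [queueSize_cons] at hn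
      rw [queueBfs_cons, List.length_cons, ih _ (by omega)]

theorem queueBfs_append (Q₁ Q₂ : List UBTree) :
    queueBfs (Q₁ ++ Q₂) =
      Q₁.map UBTree.label ++ queueBfs (Q₂ ++ Q₁.flatMap UBTree.children) := by
  induction Q₁ generalizing Q₂ with
  | nil => simp
  | cons t ts ih => simp [queueBfs_cons, ih]

theorem label_mem_queueBfs {Q : List UBTree} {t : UBTree} (ht : t ∈ Q) :
    t.label ∈ queueBfs Q := by
  have := queueBfs_append Q []
  rw [List.append_nil] at this
  rw [this]
  exact List.mem_append_left _ (List.mem_map_of_mem ht)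

/-- Every label of an increasing forest is at least the label of some root. -/
theorem exists_root_label_le {Q : List UBTree} (hQ : ∀ t ∈ Q, t.increasing) {v : ℕ}
    (hv : v ∈ queueBfs Q) : ∃ t ∈ Q, t.label ≤ v := by
  generalize hn : queueSize Q = n
  induction n generalizing Q with
  | zero =>
    rw [← length_queueBfs, List.length_eq_zero_iff] at hn
    simp [hn] at hv
  | succ n ih =>
    rcases Q with _ | ⟨t, ts⟩
    · simp at hv
    · rw [queueSize_cons] at hn
      rw [queueBfs_cons, List.mem_cons] at hv
      have ht := (t.increasing_iff_children).1 (hQ t (by simp))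
      rcases hv with rfl | hv
      · exact ⟨t, by simp, le_rfl⟩
      · obtain ⟨u, hu, hle⟩ := ih (Q := ts ++ t.children) (fun u hu ↦ by
          rcases List.mem_append.1 hu with hu | hu
          · exact hQ u (by simp [hu])
          · exact (ht u hu).2) hv (by omega)
        rcases List.mem_append.1 hu with hu | hu
        · exact ⟨u, by simp [hu], hle⟩
        · exact ⟨t, by simp, (ht u hu).1.le.trans hle⟩

/-- A queue of increasing trees whose labels in breadth-first order form a 213-avoiding
permutation of `a, a + 1, ..., a + n - 1`. -/
def IsForest213 (a n : ℕ) (Q : List UBTree) : Prop :=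
  (∀ t ∈ Q, t.increasing) ∧ IsPerm213 a n (queueBfs Q)

theorem isGoodUB_iff (t : UBTree) : IsGoodUB t ↔ IsForest213 1 t.size [t] := by
  have : t.bfs = queueBfs [t] := by simp [UBTree.bfs, queueBfs, queueSize]
  simp [IsGoodUB, IsForest213, IsPerm213, this]

theorem IsForest213.queueSize_eq {a n : ℕ} {Q : List UBTree} (h : IsForest213 a n Q) :
    queueSize Q = n := by
  rw [← length_queueBfs, h.2.length_eq]

theorem isForest213_zero_iff {a : ℕ} {Q : List UBTree} : IsForest213 a 0 Q ↔ Q = [] := by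
  constructor
  · intro h
    rcases Q with _ | ⟨t, ts⟩
    · rfl
    · have := h.queueSize_eq
      rw [queueSize_cons] at this
      omega
  · rintro rfl
    exact ⟨by simp, isPerm213_zero_iff.2 rfl⟩

/-- The roots preceding the minimum of a good forest are leaves. -/
theorem IsForest213.exists_eq {a n : ℕ} {Q : List UBTree} (h : IsForest213 a (n + 1) Q) :
    ∃ (L : List ℕ) (t : UBTree) (ts : List UBTree),
      t.label = a ∧ Q = L.map UBTree.lf ++ t :: ts := by
  obtain ⟨hinc, hp⟩ := h
  obtain ⟨t, ht, hta⟩ := exists_root_label_le hinc ((hp.mem_iff (x := a)).2 (by omega))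
  replace hta : t.label = a := le_antisymm hta (hp.mem_iff.1 (label_mem_queueBfs ht)).1
  obtain ⟨Q₁, ts, rfl⟩ := List.append_of_mem ht
  refine ⟨Q₁.map UBTree.label, t, ts, hta, ?_⟩
  rw [List.map_map]
  congr 1
  refine (List.map_id Q₁).symm.trans (List.map_congr_left fun u hu ↦ ?_)
  have hch : u.children = [] := by
    refine List.eq_nil_iff_forall_not_mem.2 fun c hc ↦ ?_
    have hlt := ((u.increasing_iff_children).1 (hinc u (by simp [hu])) c hc).1
    have hu' := (hp.mem_iff.1 (label_mem_queueBfs (t := u) (by simp [hu]))).1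
    have hnd := hp.nodup
    have hav := (avoids213_iff_triplewise _).1 hp.2
    rw [queueBfs_append, List.cons_append, queueBfs_cons] at hnd hav
    have h1 := (List.nodup_append.1 hnd).2.2 _ (List.mem_map_of_mem hu) t.label (by simp)
    have h2 := (List.triplewise_append.1 hav).2.2.1 _ (List.mem_map_of_mem hu)
    refine (List.pairwise_cons.1 h2).1 c.label (label_mem_queueBfs ?_) ⟨by omega, hlt⟩
    simp only [List.mem_append, List.mem_flatMap]
    exact .inl (.inr ⟨u, hu, hc⟩)
  cases u <;> simp [UBTree.children] at hch
  rfl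

/-- Splitting a good forest at its minimum. -/
theorem isForest213_append_cons_iff {n : ℕ} {L : List ℕ} {t : UBTree} {ts : List UBTree} :
    IsForest213 t.label (n + 1) (L.map UBTree.lf ++ t :: ts) ↔
      L.length ≤ n ∧ IsPerm213 (t.label + 1 + (n - L.length)) L.length L ∧
        IsForest213 (t.label + 1) (n - L.length) (ts ++ t.children) := by
  have hb : queueBfs (L.map UBTree.lf ++ t :: ts) =
      L ++ t.label :: queueBfs (ts ++ t.children) := by
    have h1 : (L.map UBTree.lf).map UBTree.label = L := by
      rw [List.map_map]; exact List.map_id L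
    have h2 : (L.map UBTree.lf).flatMap UBTree.children = [] := by
      simp [UBTree.children]
    rw [queueBfs_append, h1, h2, List.append_nil, queueBfs_cons]
  simp only [IsForest213, hb]
  constructor
  · rintro ⟨hinc, hp⟩
    have hle : L.length ≤ n := by
      have := hp.length_eq
      simp at this
      omega
    have hp' := hp
    rw [show n + 1 = L.length + (n - L.length) + 1 by omega, isPerm213_append_cons_iff rfl] at hp'
    refine ⟨hle, hp'.1, fun u hu ↦ ?_, hp'.2⟩
    rcases List.mem_append.1 hu with hu | hu
    · exact hinc u (by simp [hu])
    · exact ((t.increasing_iff_children).1 (hinc t (by simp)) u hu).2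
  · rintro ⟨hle, hL, hinc, hp⟩
    constructor
    · intro u hu
      rcases List.mem_append.1 hu with hu | hu
      · obtain ⟨x, -, rfl⟩ := List.mem_map.1 hu
        trivial
      · rcases List.mem_cons.1 hu with rfl | hu
        · refine (u.increasing_iff_children).2 fun c hc ↦ ⟨?_, hinc c (by simp [hc])⟩
          exact (hp.mem_iff.1 (label_mem_queueBfs (List.mem_append_right _ hc))).1
        · exact hinc u (by simp [hu])
    · rw [show n + 1 = L.length + (n - L.length) + 1 by omega]
      exact (isPerm213_append_cons_iff rfl).2 ⟨hL, hp⟩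

/-- Good forests with `n` vertices and `m` roots. -/
abbrev Forest213 (a n m : ℕ) : Type := {Q : List UBTree // IsForest213 a n Q ∧ Q.length = m}

/-- Ways of making a good forest with `k + 1` roots and `r + 1` vertices whose first root
carries the minimum `a`. -/
abbrev MinFirst213 (a r k : ℕ) : Type :=
  {q : UBTree × List UBTree // q.1.label = a ∧ q.2.length = k ∧
    IsForest213 (a + 1) r (q.2 ++ q.1.children)}

theorem nonempty_equiv_minFirst213 (a r k : ℕ) :
    Nonempty (Forest213 (a + 1) r k ⊕ Forest213 (a + 1) r (k + 1) ⊕ Forest213 (a + 1) r (k + 2) ≃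
      MinFirst213 a r k) := by
  have h1 (Q : List UBTree) (h : Q.length = k + 1) : Q.take k ++ [Q[k]] = Q := by
    rw [List.take_append_getElem, ← h, List.take_length]
  have h2 (Q : List UBTree) (h : Q.length = k + 2) : Q.take k ++ [Q[k], Q[k + 1]] = Q := by
    rw [← List.singleton_append, ← List.append_assoc, List.take_append_getElem,
      List.take_append_getElem, show k + 1 + 1 = Q.length from h.symm, List.take_length]
  let f : Forest213 (a + 1) r k ⊕ Forest213 (a + 1) r (k + 1) ⊕ Forest213 (a + 1) r (k + 2) →
      MinFirst213 a r k :=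
    Sum.elim (fun Q ↦ ⟨(.lf a, Q.1), rfl, Q.2.2, by simpa [UBTree.children] using Q.2.1⟩)
      (Sum.elim
        (fun Q ↦ ⟨(.un a (Q.1[k]'(by rw [Q.2.2]; omega)), Q.1.take k), rfl, by
          rw [List.length_take, Q.2.2]; omega, by
          simpa only [UBTree.children, h1 Q.1 Q.2.2] using Q.2.1⟩)
        (fun Q ↦ ⟨(.bin a (Q.1[k]'(by rw [Q.2.2]; omega)) (Q.1[k + 1]'(by rw [Q.2.2]; omega)),
          Q.1.take k), rfl, by
          rw [List.length_take, Q.2.2]; omega, by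
          simpa only [UBTree.children, h2 Q.1 Q.2.2] using Q.2.1⟩))
  refine ⟨Equiv.ofBijective f ⟨?_, ?_⟩⟩
  · rintro (⟨Q, hQ⟩ | ⟨Q, hQ⟩ | ⟨Q, hQ⟩) (⟨Q', hQ'⟩ | ⟨Q', hQ'⟩ | ⟨Q', hQ'⟩) h <;>
      simp [f] at h
    · simpa using h
    · have := h1 Q hQ.2
      rw [h.1, h.2, h1 Q' hQ'.2] at this
      simp [this]
    · have := h2 Q hQ.2
      rw [h.1.1, h.1.2, h.2, h2 Q' hQ'.2] at this
      simp [this]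
  · rintro ⟨⟨t | ⟨b, t⟩ | ⟨b, t, u⟩, ts⟩, rfl, rfl, h⟩
    · exact ⟨.inl ⟨ts, by simpa [UBTree.children] using h, rfl⟩, rfl⟩
    · refine ⟨.inr (.inl ⟨ts ++ [t], h, by simp⟩), ?_⟩
      refine Subtype.ext ?_
      change (UBTree.un b ((ts ++ [t])[ts.length]'(by simp)), (ts ++ [t]).take ts.length) = _
      simp
    · refine ⟨.inr (.inr ⟨ts ++ [t, u], h, by simp⟩), ?_⟩
      refine Subtype.ext ?_
      change (UBTree.bin b ((ts ++ [t, u])[ts.length]'(by simp))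
        ((ts ++ [t, u])[ts.length + 1]'(by simp)), (ts ++ [t, u]).take ts.length) = _
      simp

theorem nonempty_equiv_forest213 (a n m : ℕ) :
    Nonempty ((Σ p : antidiagonal m, {_x : Unit // p.1.1 ≤ n} ×
      {L // IsPerm213 (a + 1 + (n - p.1.1)) p.1.1 L} × MinFirst213 a (n - p.1.1) p.1.2) ≃
      Forest213 a (n + 1) (m + 1)) := by
  let f : (Σ p : antidiagonal m, {_x : Unit // p.1.1 ≤ n} ×
      {L // IsPerm213 (a + 1 + (n - p.1.1)) p.1.1 L} × MinFirst213 a (n - p.1.1) p.1.2) →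
      Forest213 a (n + 1) (m + 1) := fun ⟨⟨⟨l, k⟩, hp⟩, ⟨_, hl⟩, ⟨L, hL⟩, ⟨⟨t, ts⟩, ht, hts, h⟩⟩ ↦
    ⟨L.map UBTree.lf ++ t :: ts, by
      obtain rfl := hL.length_eq
      subst ht
      exact isForest213_append_cons_iff.2 ⟨hl, hL, h⟩, by
      have := hL.length_eq
      have := mem_antidiagonal.1 hp
      simp at *
      omega⟩
  refine ⟨Equiv.ofBijective f ⟨?_, ?_⟩⟩
  · rintro ⟨⟨⟨l, k⟩, hp⟩, ⟨_, hl⟩, ⟨L, hL⟩, ⟨⟨t, ts⟩, ht, hts, h⟩⟩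
      ⟨⟨⟨l', k'⟩, hp'⟩, ⟨_, hl'⟩, ⟨L', hL'⟩, ⟨⟨t', ts'⟩, ht', hts', h'⟩⟩ he
    simp only [f, Subtype.mk.injEq] at he
    simp only at hL hL' hts hts' ht ht'
    have hLL : L = L' := by
      have hm := congrArg (List.map UBTree.label) he
      simp only [List.map_append, List.map_cons, List.map_map, ht, ht'] at hm
      have hid (K : List ℕ) : K.map (UBTree.label ∘ UBTree.lf) = K := List.map_id K
      have ha := hL.notMem_of_lt (x := a) (by omega)
      have ha' := hL'.notMem_of_lt (x := a) (by omega)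
      rw [hid, hid] at hm
      exact prefix_eq_of_append_cons_eq ha ha' hm
    subst hLL
    obtain ⟨rfl, rfl⟩ : t = t' ∧ ts = ts' := by simpa using he
    obtain rfl := hL.length_eq.symm.trans hL'.length_eq
    obtain rfl := hts.symm.trans hts'
    rfl
  · rintro ⟨Q, hQ, hm⟩
    obtain ⟨L, t, ts, rfl, rfl⟩ := hQ.exists_eq
    obtain ⟨h1, h2, h3⟩ := isForest213_append_cons_iff.1 hQ
    refine ⟨⟨⟨(L.length, ts.length), ?_⟩, ⟨(), h1⟩, ⟨L, h2⟩, ⟨(t, ts), rfl, rfl, h3⟩⟩, rfl⟩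
    simp at hm ⊢
    omega

theorem forest213_zero_iff {a m : ℕ} {Q : List UBTree} :
    IsForest213 a 0 Q ∧ Q.length = m ↔ Q = [] ∧ m = 0 := by
  rw [isForest213_zero_iff]
  constructor
  · rintro ⟨rfl, rfl⟩; simp
  · rintro ⟨rfl, rfl⟩; simp

theorem isEmpty_forest213_succ_zero (a n : ℕ) : IsEmpty (Forest213 a (n + 1) 0) := by
  refine ⟨fun ⟨Q, hQ, h0⟩ ↦ ?_⟩
  obtain rfl := List.length_eq_zero_iff.1 h0
  exact absurd hQ.queueSize_eq (by simp [queueSize])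

instance finite_forest213 (a n m : ℕ) : Finite (Forest213 a n m) := by
  induction n using Nat.strong_induction_on generalizing a m with
  | _ n ih =>
    rcases n with _ | n
    · refine Set.Finite.to_subtype (s := {Q | IsForest213 a 0 Q ∧ Q.length = m})
        ((Set.finite_singleton []).subset fun Q hQ ↦ (forest213_zero_iff.1 hQ).1)
    · rcases m with _ | m
      · have := isEmpty_forest213_succ_zero a n
        infer_instance
      · obtain ⟨e⟩ := nonempty_equiv_forest213 a n m
        have (p : antidiagonal m) : Finite (MinFirst213 a (n - p.1.1) p.1.2) := by
          obtain ⟨e⟩ := nonempty_equiv_minFirst213 a (n - p.1.1) p.1.2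
          have (k : ℕ) := ih (n - p.1.1) (by omega) (a + 1) k
          exact Finite.of_equiv _ e
        exact Finite.of_equiv _ e

theorem card_forest213_succ (a n m : ℕ) : Nat.card (Forest213 a (n + 1) (m + 1)) =
    ∑ p ∈ antidiagonal m, catalan p.1 * if p.1 ≤ n then
      Nat.card (Forest213 (a + 1) (n - p.1) p.2) + Nat.card (Forest213 (a + 1) (n - p.1) (p.2 + 1))
        + Nat.card (Forest213 (a + 1) (n - p.1) (p.2 + 2)) else 0 := by
  obtain ⟨e⟩ := nonempty_equiv_forest213 a n m
  have hfin (r k : ℕ) : Finite (MinFirst213 a r k) := by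
    obtain ⟨e⟩ := nonempty_equiv_minFirst213 a r k
    exact Finite.of_equiv _ e
  rw [← Nat.card_congr e, Nat.card_sigma, ← Finset.sum_coe_sort (antidiagonal m)]
  refine Finset.sum_congr rfl fun p _ ↦ ?_
  obtain ⟨e⟩ := nonempty_equiv_minFirst213 a (n - p.1.1) p.1.2
  rw [Nat.card_prod, Nat.card_prod, card_isPerm213, ← Nat.card_congr e, Nat.card_sum,
    Nat.card_sum, ← add_assoc]
  split_ifs with h <;> simp [h]

theorem card_forest213_eq (a b n m : ℕ) :
    Nat.card (Forest213 a n m) = Nat.card (Forest213 b n m) := by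
  induction n using Nat.strong_induction_on generalizing a b m with
  | _ n ih =>
    rcases n with _ | n
    · simp only [Forest213, forest213_zero_iff]
    · rcases m with _ | m
      · have := isEmpty_forest213_succ_zero a n
        have := isEmpty_forest213_succ_zero b n
        simp
      · rw [card_forest213_succ, card_forest213_succ]
        have h (p : ℕ × ℕ) (k : ℕ) := ih (n - p.1) (by omega) (a + 1) (b + 1) k
        simp only [h]

theorem card_isGoodUB (n : ℕ) :
    Nat.card {t : UBTree // t.size = n ∧ IsGoodUB t} = Nat.card (Forest213 1 n 1) := by
  refine Nat.card_congr (Equiv.ofBijective (fun t ↦ ⟨[t.1], ?_, rfl⟩) ⟨?_, ?_⟩)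
  · have := (isGoodUB_iff t.1).1 t.2.2
    rwa [t.2.1] at this
  · intro t u h
    simpa [Subtype.ext_iff] using h
  · rintro ⟨Q, hQ, h1⟩
    obtain ⟨t, rfl⟩ := List.length_eq_one_iff.1 h1
    have ht : t.size = n := by simpa [queueSize] using hQ.queueSize_eq
    exact ⟨⟨t, ht, (isGoodUB_iff t).2 (ht ▸ hQ)⟩, rfl⟩

end Forests

/-- Summatory formula for the number of `n`-vertex increasing unary-binary trees
with associated permutation avoiding 213. -/
theorem stmt4 (n : ℕ) (hn : 1 ≤ n) :
    (n : ℤ) * Nat.card {t : UBTree // t.size = n ∧ IsGoodUB t} =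
      ∑ k ∈ Finset.Icc 1 n,
        (-1 : ℤ) ^ (k + 1) * (Nat.choose (2 * k - 2) (k - 1) : ℤ) *
          (Nat.choose (2 * n) (n - k) : ℤ) := by
  let f (n m : ℕ) : ℕ := Nat.card (Forest213 1 n m)
  have h00 : f 0 0 = 1 := by
    simp [f, Forest213, isForest213_zero_iff]
  have h0 (m : ℕ) : f 0 (m + 1) = 0 := by
    simp [f, Forest213, forest213_zero_iff]
  have hs0 (n : ℕ) : f (n + 1) 0 = 0 := by
    have := isEmpty_forest213_succ_zero 1 n
    exact Nat.card_of_isEmpty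
  have hA := one_add_add_sq_eq_catalan f h00 h0 hs0 fun n m ↦ by
    simp only [f, card_forest213_succ]
    simp only [card_forest213_eq (1 + 1) 1]
  have h := mul_coeff_eq_sum_of_one_add_add_sq (by
    rw [← PowerSeries.coeff_zero_eq_constantCoeff_apply, PowerSeries.coeff_mk, h0 0,
      Nat.cast_zero]) hA n
  rwa [PowerSeries.coeff_mk, show f n 1 = _ from (card_isGoodUB n).symm] at h
end
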